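/- Let X be a random vector in ℝⁿ whose law is the multivariate Gaussian measure with mean μ ∈ ℝⁿ and positive-definite covariance matrix Σ, let A ∈ ℝⁿ be a nonzero vector and b ∈ ℝ. Then for every δ ∈ (0, 1): Pr(Aᵀ X < b) ≤ δ if and only if Aᵀ μ − b ≥ √(2 Aᵀ Σ A) · erf⁻¹(1 − 2δ), equivalently if and only if erf((Aᵀ μ − b) / √(2 Aᵀ Σ A)) ≥ 1 − 2δ. -/

import Mathlib

open MeasureTheory ProbabilityTheory Real
open scoped RealInnerProductSpace

/-- The Gauss error function `erf z = (2/√π) ∫ t in 0..z, exp (-t²)`. -/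
noncomputable def erf (z : ℝ) : ℝ :=
  (2 / Real.sqrt Real.pi) * ∫ t in (0:ℝ)..z, Real.exp (-t ^ 2)

/-- The inverse of the Gauss error function. -/
noncomputable def erfInv : ℝ → ℝ :=
  Function.invFun erf

/-- The multivariate Gaussian measure on `EuclideanSpace ℝ (Fin n)` with mean `μ` and
(positive-definite) covariance matrix `S`, given by its density
`(√((2π)ⁿ det S))⁻¹ exp (-⟪x - μ, S⁻¹ (x - μ)⟫ / 2)` with respect to Lebesgue measure. -/
noncomputable def mvGaussian {n : ℕ} (μ : EuclideanSpace ℝ (Fin n))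
    (S : Matrix (Fin n) (Fin n) ℝ) : Measure (EuclideanSpace ℝ (Fin n)) :=
  volume.withDensity fun x =>
    ENNReal.ofReal ((Real.sqrt ((2 * Real.pi) ^ n * S.det))⁻¹ *
      Real.exp (-⟪x - μ, Matrix.toEuclideanLin S⁻¹ (x - μ)⟫ / 2))

theorem integrable_exp_neg_sq : Integrable fun t : ℝ => Real.exp (-t ^ 2) := by
  simpa using integrable_exp_neg_mul_sq one_pos

theorem integral_exp_neg_sq_Ioi_zero :
    ∫ t in Set.Ioi (0:ℝ), Real.exp (-t ^ 2) = Real.sqrt Real.pi / 2 := by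
  simpa using integral_gaussian_Ioi 1

/-- The complementary error function as a Gaussian tail integral. -/
theorem one_sub_erf (z : ℝ) :
    1 - erf z = (2 / Real.sqrt Real.pi) * ∫ t in Set.Ioi z, Real.exp (-t ^ 2) := by
  have h := intervalIntegral.integral_interval_add_Ioi (a := 0) (b := z)
    integrable_exp_neg_sq.integrableOn integrable_exp_neg_sq.integrableOn
  rw [integral_exp_neg_sq_Ioi_zero] at h
  have hπ : Real.sqrt Real.pi ≠ 0 := by positivity
  rw [erf, eq_sub_of_add_eq' h]
  field_simp

theorem erf_neg (z : ℝ) : erf (-z) = -erf z := by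
  have h := intervalIntegral.integral_comp_neg (a := 0) (b := z)
    (fun t : ℝ => Real.exp (-t ^ 2))
  simp only [neg_sq, neg_zero] at h
  rw [erf, erf, intervalIntegral.integral_symm, ← h, mul_neg]

theorem strictMono_erf : StrictMono erf := by
  intro x y hxy
  have hint : ∀ a b : ℝ, IntervalIntegrable (fun t : ℝ => Real.exp (-t ^ 2)) volume a b :=
    fun a b => integrable_exp_neg_sq.intervalIntegrable
  have hpos : 0 < ∫ t in x..y, Real.exp (-t ^ 2) :=
    intervalIntegral.intervalIntegral_pos_of_pos (hint x y) (fun t => Real.exp_pos _) hxy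
  rw [erf, erf, ← intervalIntegral.integral_add_adjacent_intervals (hint 0 x) (hint x y)]
  gcongr
  linarith

theorem continuous_erf : Continuous erf :=
  continuous_const.mul
    (intervalIntegral.continuous_primitive
      (fun _ _ => integrable_exp_neg_sq.intervalIntegrable) 0)

theorem tendsto_erf_atTop : Filter.Tendsto erf Filter.atTop (nhds 1) := by
  have h := (intervalIntegral_tendsto_integral_Ioi 0 integrable_exp_neg_sq.integrableOn
    Filter.tendsto_id).const_mul (2 / Real.sqrt Real.pi)
  rw [integral_exp_neg_sq_Ioi_zero] at h
  have hπ : 2 / Real.sqrt Real.pi * (Real.sqrt Real.pi / 2) = 1 := by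
    have : Real.sqrt Real.pi ≠ 0 := by positivity
    field_simp
  rwa [hπ] at h

theorem tendsto_erf_atBot : Filter.Tendsto erf Filter.atBot (nhds (-1)) := by
  have h := (tendsto_erf_atTop.comp Filter.tendsto_neg_atBot_atTop).neg
  refine h.congr fun z => ?_
  simp [erf_neg]

theorem mem_range_erf {y : ℝ} (hy : y ∈ Set.Ioo (-1:ℝ) 1) : y ∈ Set.range erf :=
  mem_range_of_exists_le_of_exists_ge continuous_erf
    ((tendsto_erf_atBot.eventually_le_const hy.1).exists)
    ((tendsto_erf_atTop.eventually_const_le hy.2).exists)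

theorem erf_erfInv {y : ℝ} (hy : y ∈ Set.Ioo (-1:ℝ) 1) : erf (erfInv y) = y :=
  Function.invFun_eq (mem_range_erf hy)

/-- The distribution function of a nondegenerate real Gaussian in terms of `erf`. -/
theorem gaussianReal_Iio (m b : ℝ) {v : NNReal} (hv : v ≠ 0) :
    gaussianReal m v (Set.Iio b) =
      ENNReal.ofReal ((1 - erf ((m - b) / Real.sqrt (2 * v))) / 2) := by
  have hv' : (0:ℝ) < v := by positivity
  have hs : 0 < Real.sqrt (2 * v) := by positivity
  have hmap : gaussianReal m v =
      (gaussianReal 0 (1 / 2)).map (fun x => m - Real.sqrt (2 * v) * x) := by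
    have hcomp : (fun x : ℝ => m - Real.sqrt (2 * v) * x) =
        (fun x => m - x) ∘ (fun x => Real.sqrt (2 * v) * x) := rfl
    rw [hcomp, ← Measure.map_map (by fun_prop) (by fun_prop), gaussianReal_map_const_mul,
      gaussianReal_map_const_sub]
    congr 1
    · simp
    · ext
      simp only [one_div, NNReal.coe_mul, NNReal.coe_mk, NNReal.coe_inv, NNReal.coe_ofNat]
      rw [Real.sq_sqrt (by positivity)]
      ring
  have hpre : (fun x => m - Real.sqrt (2 * v) * x) ⁻¹' Set.Iio b =
      Set.Ioi ((m - b) / Real.sqrt (2 * v)) := by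
    ext x
    simp only [Set.mem_preimage, Set.mem_Iio, Set.mem_Ioi, div_lt_iff₀ hs]
    constructor <;> intro h <;> linarith
  rw [hmap, Measure.map_apply (by fun_prop) measurableSet_Iio, hpre,
    gaussianReal_apply_eq_integral _ (by simp), one_sub_erf]
  congr 1
  rw [mul_div_right_comm, ← integral_const_mul]
  refine integral_congr_ae (Filter.Eventually.of_forall fun t => ?_)
  simp only [gaussianPDFReal, sub_zero, NNReal.coe_div, NNReal.coe_one, NNReal.coe_ofNat]
  congr 1
  · rw [mul_one_div, mul_div_right_comm, div_self two_ne_zero, one_mul]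
    field_simp
  · norm_num

/-- The characteristic function of `mvGaussian μ S` is that of a Gaussian measure. -/
theorem charFun_mvGaussian {n : ℕ} (μ : EuclideanSpace ℝ (Fin n))
    {S : Matrix (Fin n) (Fin n) ℝ} (hS : S.PosDef) [IsProbabilityMeasure (mvGaussian μ S)]
    (t : EuclideanSpace ℝ (Fin n)) :
    charFun (mvGaussian μ S) t =
      Complex.exp (⟪μ, t⟫ * Complex.I - ⟪t, Matrix.toEuclideanLin S t⟫ / 2) := by
  obtain ⟨B, hB, rfl⟩ : ∃ B : Matrix (Fin n) (Fin n) ℝ, IsUnit B ∧ S = B.conjTranspose * B := by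
    open scoped MatrixOrder Matrix.Norms.L2Operator in
    obtain ⟨B, hB⟩ := CStarAlgebra.nonneg_iff_eq_star_mul_self.mp hS.posSemidef.nonneg
    refine ⟨B, ?_, hB⟩
    have hdet := hS.det_pos.ne'
    rw [hB, Matrix.det_mul] at hdet
    exact (Matrix.isUnit_iff_isUnit_det B).mpr (right_ne_zero_of_mul hdet).isUnit
  have hBdet : IsUnit B.det := (Matrix.isUnit_iff_isUnit_det B).mp hB
  have hBdet' : IsUnit B.conjTranspose.det := by
    rw [Matrix.det_conjTranspose]
    exact hBdet.star
  set R := Matrix.toEuclideanLin B with hR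
  set T := LinearMap.adjoint R
  have hTB : T = Matrix.toEuclideanLin B.conjTranspose :=
    (Matrix.toEuclideanLin_conjTranspose_eq_adjoint B).symm
  have hcov : ∀ x, ⟪x, Matrix.toEuclideanLin (B.conjTranspose * B) x⟫ = ‖R x‖ ^ 2 := by
    intro x
    have hcomp : Matrix.toEuclideanLin (B.conjTranspose * B) x = T (R x) := by
      rw [hTB, hR]
      simp [Matrix.toLpLin_apply]
    rw [hcomp, LinearMap.adjoint_inner_right, real_inner_self_eq_norm_sq]
  have hinv : ∀ y, ⟪T y, Matrix.toEuclideanLin (B.conjTranspose * B)⁻¹ (T y)⟫ = ‖y‖ ^ 2 := by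
    intro y
    have hcomp : R (Matrix.toEuclideanLin (B.conjTranspose * B)⁻¹ (T y)) = y := by
      have hone : B * ((B.conjTranspose * B)⁻¹ * B.conjTranspose) = 1 := by
        rw [Matrix.mul_inv_rev, Matrix.nonsing_inv_mul_cancel_right _ _ hBdet',
          Matrix.mul_nonsing_inv _ hBdet]
      rw [hTB, hR]
      simp only [Matrix.toLpLin_apply, Matrix.mulVec_mulVec, hone, Matrix.one_mulVec]
    rw [LinearMap.adjoint_inner_left, hcomp, real_inner_self_eq_norm_sq]
  have hinj : Function.Injective T := by
    intro x y hxy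
    have h := hinv (x - y)
    rw [map_sub, hxy, sub_self, inner_zero_left] at h
    exact sub_eq_zero.mp (norm_eq_zero.mp (pow_eq_zero_iff two_ne_zero |>.mp h.symm))
  set c : ℝ := (Real.sqrt ((2 * Real.pi) ^ n * (B.conjTranspose * B).det))⁻¹
  have hformula : ∃ K : ℂ, ∀ s, charFun (mvGaussian μ (B.conjTranspose * B)) s =
      K * Complex.exp (⟪μ, s⟫ * Complex.I - ‖R s‖ ^ 2 / 2) := by
    have himage : (fun y => μ + T y) '' Set.univ = Set.univ := by
      rw [Set.image_univ, Set.range_eq_univ]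
      exact (Equiv.addLeft μ).surjective.comp (LinearMap.injective_iff_surjective.mp hinj)
    have hderiv : ∀ y ∈ Set.univ, HasFDerivWithinAt (fun y => μ + T y)
        (LinearMap.toContinuousLinearMap T) Set.univ y := fun y _ =>
      ((LinearMap.toContinuousLinearMap T).hasFDerivAt.const_add μ).hasFDerivWithinAt
    refine ⟨|(LinearMap.toContinuousLinearMap T).det| * c *
      (Real.pi / (1 / 2 : ℂ)) ^ ((Module.finrank ℝ (EuclideanSpace ℝ (Fin n)) : ℂ) / 2),
      fun s => ?_⟩
    rw [charFun_apply, mvGaussian, integral_withDensity_eq_integral_toReal_smul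
      (by fun_prop) (Filter.Eventually.of_forall fun _ => ENNReal.ofReal_lt_top),
      ← setIntegral_univ, ← himage,
      integral_image_eq_integral_abs_det_fderiv_smul volume MeasurableSet.univ hderiv
        ((add_right_injective μ).comp hinj).injOn, setIntegral_univ]
    have hintegrand : ∀ y : EuclideanSpace ℝ (Fin n),
        |(LinearMap.toContinuousLinearMap T).det| •
          (ENNReal.ofReal (c * Real.exp (-⟪μ + T y - μ,
            Matrix.toEuclideanLin (B.conjTranspose * B)⁻¹ (μ + T y - μ)⟫ / 2))).toReal •
          Complex.exp (⟪μ + T y, s⟫ * Complex.I) =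
        |(LinearMap.toContinuousLinearMap T).det| * c * Complex.exp (⟪μ, s⟫ * Complex.I) *
          Complex.exp (-(1 / 2 : ℂ) * ‖y‖ ^ 2 + Complex.I * ⟪R s, y⟫) := by
      intro y
      rw [add_sub_cancel_left, hinv, ENNReal.toReal_ofReal (by positivity), inner_add_left,
        LinearMap.adjoint_inner_left, real_inner_comm y (R s), Complex.real_smul,
        Complex.real_smul, Complex.ofReal_mul, Complex.ofReal_exp, mul_assoc, mul_assoc,
        mul_assoc, ← Complex.exp_add, ← Complex.exp_add]
      push_cast
      ring_nf
    refine (integral_congr_ae (Filter.Eventually.of_forall hintegrand)).trans ?_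
    rw [integral_const_mul, GaussianFourier.integral_cexp_neg_mul_sq_norm_add (by norm_num),
      sub_eq_add_neg, Complex.exp_add, Complex.I_sq]
    ring_nf
  obtain ⟨K, hK⟩ := hformula
  have hK1 : K = 1 := by
    have h0 := hK 0
    rw [charFun_zero, probReal_univ] at h0
    simpa using h0.symm
  rw [hK, hK1, one_mul, hcov]
  norm_cast

theorem map_inner_mvGaussian {n : ℕ} (μ : EuclideanSpace ℝ (Fin n))
    {S : Matrix (Fin n) (Fin n) ℝ} (hS : S.PosDef) [IsProbabilityMeasure (mvGaussian μ S)]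
    (A : EuclideanSpace ℝ (Fin n)) {v : NNReal} (hv : v = ⟪A, Matrix.toEuclideanLin S A⟫) :
    (mvGaussian μ S).map (fun x => ⟪A, x⟫) = gaussianReal ⟪A, μ⟫ v := by
  have hm : Measurable fun x : EuclideanSpace ℝ (Fin n) => ⟪A, x⟫ := by fun_prop
  have := Measure.isProbabilityMeasure_map (μ := mvGaussian μ S) hm.aemeasurable
  refine Measure.ext_of_charFun (funext fun t => ?_)
  have hcf : charFun ((mvGaussian μ S).map (fun x => ⟪A, x⟫)) t =
      charFun (mvGaussian μ S) (t • A) := by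
    rw [charFun_apply, charFun_apply, integral_map hm.aemeasurable (by fun_prop)]
    simp [real_inner_smul_right, real_inner_comm]
  rw [hcf, charFun_mvGaussian μ hS, charFun_gaussianReal, map_smul, real_inner_smul_left,
    real_inner_smul_right, real_inner_smul_right, ← hv, real_inner_comm]
  push_cast
  ring_nf

theorem inner_toEuclideanLin_pos {n : ℕ} {S : Matrix (Fin n) (Fin n) ℝ} (hS : S.PosDef)
    {A : EuclideanSpace ℝ (Fin n)} (hA : A ≠ 0) : 0 < ⟪A, Matrix.toEuclideanLin S A⟫ := by
  have h := hS.dotProduct_mulVec_pos (x := A.ofLp) (by simpa using hA)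
  simpa [EuclideanSpace.inner_eq_star_dotProduct, Matrix.toLpLin_apply, dotProduct_comm] using h

/-- **Lemma 2**: for a random vector `X` with multivariate Gaussian law of mean `μ` and
positive-definite covariance `Σ`, and a nonzero vector `A` and scalar `b`, the chance
constraint `Pr(Aᵀ X < b) ≤ δ` is equivalent to the deterministic linear constraint
`Aᵀ μ - b ≥ √(2 Aᵀ Σ A) · erf⁻¹(1 - 2δ)`, equivalently
`erf ((Aᵀ μ - b)/√(2 Aᵀ Σ A)) ≥ 1 - 2δ`. -/
theorem stmt2 {n : ℕ} {Ω : Type*} [MeasurableSpace Ω] (P : Measure Ω)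
    [IsProbabilityMeasure P] (X : Ω → EuclideanSpace ℝ (Fin n)) (hX : Measurable X)
    (μ : EuclideanSpace ℝ (Fin n)) (S : Matrix (Fin n) (Fin n) ℝ) (hS : S.PosDef)
    (hlaw : P.map X = mvGaussian μ S)
    (A : EuclideanSpace ℝ (Fin n)) (hA : A ≠ 0) (b : ℝ)
    (δ : ℝ) (hδ : δ ∈ Set.Ioo (0:ℝ) 1) :
    (P {ω | ⟪A, X ω⟫ < b} ≤ ENNReal.ofReal δ ↔
      ⟪A, μ⟫ - b ≥ Real.sqrt (2 * ⟪A, Matrix.toEuclideanLin S A⟫) * erfInv (1 - 2 * δ)) ∧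
    (P {ω | ⟪A, X ω⟫ < b} ≤ ENNReal.ofReal δ ↔
      erf ((⟪A, μ⟫ - b) / Real.sqrt (2 * ⟪A, Matrix.toEuclideanLin S A⟫)) ≥ 1 - 2 * δ) := by
  have hv := inner_toEuclideanLin_pos hS hA
  have : IsProbabilityMeasure (mvGaussian μ S) :=
    hlaw ▸ Measure.isProbabilityMeasure_map hX.aemeasurable
  lift ⟪A, Matrix.toEuclideanLin S A⟫ to NNReal using hv.le with v hvA
  have hs : 0 < Real.sqrt (2 * (v : ℝ)) := by positivity
  have hprob : P {ω | ⟪A, X ω⟫ < b} =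
      ENNReal.ofReal ((1 - erf ((⟪A, μ⟫ - b) / Real.sqrt (2 * v))) / 2) := by
    have hm : Measurable fun x : EuclideanSpace ℝ (Fin n) => ⟪A, x⟫ := by fun_prop
    rw [← gaussianReal_Iio _ _ (by exact_mod_cast hv.ne'), ← map_inner_mvGaussian μ hS A hvA,
      ← hlaw, Measure.map_map hm hX, Measure.map_apply (hm.comp hX) measurableSet_Iio]
    rfl
  have herf : P {ω | ⟪A, X ω⟫ < b} ≤ ENNReal.ofReal δ ↔
      erf ((⟪A, μ⟫ - b) / Real.sqrt (2 * v)) ≥ 1 - 2 * δ := by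
    rw [hprob, ENNReal.ofReal_le_ofReal_iff hδ.1.le]
    constructor <;> intro h <;> linarith
  refine ⟨herf.trans ?_, herf⟩
  have hδ' : 1 - 2 * δ ∈ Set.Ioo (-1:ℝ) 1 := ⟨by linarith [hδ.2], by linarith [hδ.1]⟩
  conv_lhs => rw [← erf_erfInv hδ', ge_iff_le, strictMono_erf.le_iff_le, le_div_iff₀ hs, mul_comm]
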